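/- Let A₁, …, A_k be n×n complex matrices, let B be the kn×kn block matrix whose first block column is (A₁; A₂; …; A_k) and whose other blocks are zero, and let C be the kn×kn block matrix whose first block row is (A₁, A₂, …, A_k) and whose other blocks are zero. Let p, q ∈ [1,∞] with 1/p + 1/q = 1. Then: (1) ‖B‖_{p,p} ≤ (Σ_{i=1}^k ‖A_i‖_{p,p}^p)^{1/p} and ‖C‖_{p,p} ≤ (Σ_{i=1}^k ‖A_i‖_{p,p}^q)^{1/q}; (2) if there exists ξ ∈ ℂ^n with ‖ξ‖_p = 1 and ‖A_i ξ‖_p = ‖A_i‖_{p,p} for all 1 ≤ i ≤ k, then ‖B‖_{p,p} = (Σ_{i=1}^k ‖A_i‖_{p,p}^p)^{1/p}; (3) if there exists η ∈ ℂ^n with ‖η‖_q = 1 and ‖A_i* η‖_q = ‖A_i*‖_{q,q} for all 1 ≤ i ≤ k, then ‖C‖_{p,p} = (Σ_{i=1}^k ‖A_i‖_{p,p}^q)^{1/q}. -/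

import Mathlib

open scoped BigOperators ENNReal
open Matrix

/-- The `ℓ^p` norm of a finitely-indexed vector (with the convention `1/∞ = 0`). -/
noncomputable def lpNorm {ι : Type*} [Fintype ι] {E : Type*} [Norm E] (p : ℝ≥0∞)
    (x : ι → E) : ℝ :=
  if p = ∞ then ⨆ i, ‖x i‖ else (∑ i, ‖x i‖ ^ p.toReal) ^ p.toReal⁻¹

/-- The operator norm of a square complex matrix acting on `ℓ^p`. -/
noncomputable def opNorm {ι : Type*} [Fintype ι] (p : ℝ≥0∞) (A : Matrix ι ι ℂ) : ℝ :=
  sSup {r : ℝ | ∃ x : ι → ℂ, lpNorm p x = 1 ∧ r = lpNorm p (A.mulVec x)}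

/-- A unitary permutation matrix: a permutation matrix whose nonzero entries are
unimodular complex numbers. -/
def IsUnitaryPermutation {n : ℕ} (S : Matrix (Fin n) (Fin n) ℂ) : Prop :=
  ∃ (σ : Equiv.Perm (Fin n)) (α : Fin n → ℂ), (∀ i, ‖α i‖ = 1) ∧
    ∀ i j, S i j = if j = σ i then α i else 0

/-- `A` is logarithmic affine: `‖A‖_{p,p} = ‖A‖_{1,1}^{1/p} ‖A‖_{∞,∞}^{1-1/p}` for all
`p ∈ [1,∞]` (with `1/∞ = 0`). -/
def LogAffine {ι : Type*} [Fintype ι] (A : Matrix ι ι ℂ) : Prop :=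
  ∀ p : ℝ≥0∞, 1 ≤ p →
    opNorm p A = opNorm 1 A ^ p.toReal⁻¹ * opNorm ⊤ A ^ (1 - p.toReal⁻¹)

/-- The circulant matrix `C(α₀,…,α_{n-1})`, whose `(i,j)` entry is `α_{j-i mod n}`. -/
noncomputable def circulantC {n : ℕ} (α : Fin n → ℂ) : Matrix (Fin n) (Fin n) ℂ :=
  Matrix.of fun i j => α (j - i)

/-- The Hankel-type matrix `H(α₀,…,α_{n-1})`, whose `(i,j)` entry is `α_{i+j mod n}`. -/
noncomputable def hankelH {n : ℕ} (α : Fin n → ℂ) : Matrix (Fin n) (Fin n) ℂ :=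
  Matrix.of fun i j => α (i + j)

section LpNorm

variable {ι κ E : Type*} [Fintype ι] [Fintype κ] [SeminormedAddCommGroup E]

theorem lpNorm_top (x : ι → E) : lpNorm ∞ x = ⨆ i, ‖x i‖ := if_pos rfl

theorem lpNorm_of_ne_top {p : ℝ≥0∞} (hp : p ≠ ∞) (x : ι → E) :
    lpNorm p x = (∑ i, ‖x i‖ ^ p.toReal) ^ p.toReal⁻¹ := if_neg hp

theorem lpNorm_one (x : ι → E) : lpNorm 1 x = ∑ i, ‖x i‖ := by
  simp [lpNorm_of_ne_top]

theorem lpNorm_nonneg (p : ℝ≥0∞) (x : ι → E) : 0 ≤ lpNorm p x := by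
  unfold lpNorm
  split_ifs
  · exact Real.iSup_nonneg fun i => norm_nonneg _
  · positivity

theorem lpNorm_eq_norm_toLp (p : ℝ≥0∞) [Fact (1 ≤ p)] (x : ι → E) :
    lpNorm p x = ‖WithLp.toLp p x‖ := by
  rcases eq_or_ne p ∞ with rfl | hp
  · rw [lpNorm_top, PiLp.norm_eq_ciSup]
  · rw [lpNorm_of_ne_top hp, PiLp.norm_eq_sum ((p.toReal_pos_iff_ne_top).2 hp), one_div]

theorem lpNorm_smul {𝕜 : Type*} [NormedField 𝕜] [NormedSpace 𝕜 E] {p : ℝ≥0∞} (hp : 1 ≤ p) (c : 𝕜)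
    (x : ι → E) : lpNorm p (c • x) = ‖c‖ * lpNorm p x := by
  have : Fact (1 ≤ p) := ⟨hp⟩
  rw [lpNorm_eq_norm_toLp, lpNorm_eq_norm_toLp, WithLp.toLp_smul, norm_smul]

theorem lpNorm_zero {p : ℝ≥0∞} (hp : 1 ≤ p) : lpNorm p (0 : ι → E) = 0 := by
  have : Fact (1 ≤ p) := ⟨hp⟩
  rw [lpNorm_eq_norm_toLp, WithLp.toLp_zero, norm_zero]

theorem norm_le_lpNorm {p : ℝ≥0∞} (hp : 1 ≤ p) (x : ι → E) (i : ι) : ‖x i‖ ≤ lpNorm p x := by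
  have : Fact (1 ≤ p) := ⟨hp⟩
  rw [lpNorm_eq_norm_toLp]
  exact PiLp.norm_apply_le (WithLp.toLp p x) i

theorem lpNorm_single [DecidableEq ι] {p : ℝ≥0∞} (hp : 1 ≤ p) (i : ι) (a : E) :
    lpNorm p (Pi.single i a) = ‖a‖ := by
  have : Fact (1 ≤ p) := ⟨hp⟩
  rw [lpNorm_eq_norm_toLp]
  exact PiLp.norm_single p (fun _ => E) i a

theorem lpNorm_mono {F : Type*} [SeminormedAddCommGroup F] (p : ℝ≥0∞) {x : ι → E} {y : ι → F}
    (h : ∀ i, ‖x i‖ ≤ ‖y i‖) : lpNorm p x ≤ lpNorm p y := by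
  unfold lpNorm
  split_ifs
  · exact ciSup_mono (Set.finite_range _).bddAbove h
  · gcongr with i
    exact h i

theorem lpNorm_prod {p : ℝ≥0∞} (hp : 1 ≤ p) (x : ι × κ → E) :
    lpNorm p x = lpNorm p fun i => lpNorm p fun j => x (i, j) := by
  rcases eq_or_ne p ∞ with rfl | hpt
  · apply le_antisymm
    · rw [lpNorm_top x]
      refine Real.iSup_le (fun ij => ?_) (lpNorm_nonneg _ _)
      refine (norm_le_lpNorm hp (fun j => x (ij.1, j)) ij.2).trans ?_
      exact (Real.le_norm_self _).trans
        (norm_le_lpNorm hp (fun i => lpNorm ∞ fun j => x (i, j)) ij.1)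
    · rw [lpNorm_top fun i => lpNorm ∞ fun j => x (i, j)]
      refine Real.iSup_le (fun i => ?_) (lpNorm_nonneg _ _)
      rw [Real.norm_of_nonneg (lpNorm_nonneg _ _), lpNorm_top]
      exact Real.iSup_le (fun j => norm_le_lpNorm hp x (i, j)) (lpNorm_nonneg _ _)
  · have h0 : p.toReal ≠ 0 := (ENNReal.toReal_pos (one_pos.trans_le hp).ne' hpt).ne'
    rw [lpNorm_of_ne_top hpt, lpNorm_of_ne_top hpt, Fintype.sum_prod_type]
    congr 1
    refine Finset.sum_congr rfl fun i _ => ?_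
    rw [Real.norm_of_nonneg (lpNorm_nonneg _ _), lpNorm_of_ne_top hpt,
      Real.rpow_inv_rpow (by positivity) h0]

theorem sum_norm_mul_norm_le {R : Type*} [SeminormedRing R] {p q : ℝ≥0∞}
    (h : p.HolderConjugate q) (x y : ι → R) :
    ∑ i, ‖x i‖ * ‖y i‖ ≤ lpNorm p x * lpNorm q y := by
  rcases eq_or_ne p ∞ with rfl | hp
  · obtain rfl : q = 1 := (ENNReal.HolderConjugate.eq_top_iff_eq_one ∞ q).1 rfl
    rw [lpNorm_one, Finset.mul_sum]
    gcongr with i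
    exact norm_le_lpNorm le_top x i
  rcases eq_or_ne q ∞ with rfl | hq
  · have := h.symm
    obtain rfl : p = 1 := (ENNReal.HolderConjugate.eq_top_iff_eq_one ∞ p).1 rfl
    rw [lpNorm_one, Finset.sum_mul]
    gcongr with i
    exact norm_le_lpNorm le_top y i
  · rw [lpNorm_of_ne_top hp, lpNorm_of_ne_top hq, ← one_div, ← one_div]
    exact Real.inner_le_Lp_mul_Lq_of_nonneg _ (ENNReal.HolderConjugate.toReal_of_ne_top hp hq)
      (fun _ _ => norm_nonneg _) (fun _ _ => norm_nonneg _)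

theorem exists_norming_real {p q : ℝ≥0∞} (h : p.HolderConjugate q) (y : ι → E) :
    ∃ g : ι → ℝ, lpNorm p g ≤ 1 ∧ ∑ i, g i * ‖y i‖ = lpNorm q y := by
  classical
  rcases eq_or_ne p ∞ with rfl | hp
  · obtain rfl : q = 1 := (ENNReal.HolderConjugate.eq_top_iff_eq_one ∞ q).1 rfl
    refine ⟨1, ?_, by simp [lpNorm_one]⟩
    rw [lpNorm_top]
    exact Real.iSup_le (fun i => by simp) zero_le_one
  rcases eq_or_ne q ∞ with rfl | hq
  · have := h.symm
    obtain rfl : p = 1 := (ENNReal.HolderConjugate.eq_top_iff_eq_one ∞ p).1 rfl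
    rcases isEmpty_or_nonempty ι with hι | hι
    · exact ⟨0, by simp [lpNorm_one], by simp [lpNorm_top]⟩
    · obtain ⟨i, hi⟩ := exists_eq_ciSup_of_finite (f := fun i => ‖y i‖)
      refine ⟨Pi.single i 1, by simp [lpNorm_single], ?_⟩
      rw [lpNorm_top, ← hi]
      simp [Pi.single_apply]
  · have hpq : p.toReal.HolderConjugate q.toReal :=
      ENNReal.HolderConjugate.toReal_of_ne_top hp hq
    obtain ⟨g, hg, hgy⟩ := (NNReal.isGreatest_Lp Finset.univ (fun i => ‖y i‖₊) hpq.symm).1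
    refine ⟨fun i => g i, ?_, ?_⟩
    · rw [lpNorm_of_ne_top hp]
      refine Real.rpow_le_one (by positivity) ?_ hpq.inv_nonneg
      simpa [← NNReal.coe_le_coe] using hg
    · rw [lpNorm_of_ne_top hq]
      simpa [mul_comm] using congrArg NNReal.toReal hgy

theorem exists_norming {p q : ℝ≥0∞} (h : p.HolderConjugate q) (y : ι → ℂ) :
    ∃ x : ι → ℂ, lpNorm p x ≤ 1 ∧ star x ⬝ᵥ y = lpNorm q y := by
  obtain ⟨g, hg, hgy⟩ := exists_norming_real h y
  have hphase : ∀ z : ℂ, ∃ u : ℂ, ‖u‖ ≤ 1 ∧ star u * z = ‖z‖ := by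
    intro z
    rcases eq_or_ne z 0 with rfl | hz
    · exact ⟨0, by simp⟩
    · have hz' : (‖z‖ : ℂ) ≠ 0 := by simpa using hz
      refine ⟨z / ‖z‖, by simp [hz], ?_⟩
      simp only [RCLike.star_def, map_div₀, Complex.conj_ofReal]
      rw [div_mul_eq_mul_div, Complex.conj_mul', sq, mul_div_assoc, div_self hz', mul_one]
  choose u hu huz using hphase
  refine ⟨fun i => g i * u (y i), (lpNorm_mono p fun i => ?_).trans hg, ?_⟩
  · rw [norm_mul, Complex.norm_real]
    exact mul_le_of_le_one_right (norm_nonneg _) (hu _)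
  · rw [← hgy, dotProduct, Complex.ofReal_sum]
    refine Finset.sum_congr rfl fun i _ => ?_
    rw [Pi.star_apply, star_mul', mul_assoc, huz]
    simp

end LpNorm

section OpNorm

variable {ι : Type*} [Fintype ι]

theorem opNorm_nonneg (p : ℝ≥0∞) (A : Matrix ι ι ℂ) : 0 ≤ opNorm p A := by
  refine Real.sSup_nonneg ?_
  rintro r ⟨x, -, rfl⟩
  exact lpNorm_nonneg _ _

theorem opNorm_le_of_forall {p : ℝ≥0∞} {A : Matrix ι ι ℂ} {c : ℝ} (hc : 0 ≤ c)
    (h : ∀ x, lpNorm p (A *ᵥ x) ≤ c * lpNorm p x) : opNorm p A ≤ c := by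
  refine Real.sSup_le ?_ hc
  rintro r ⟨x, hx, rfl⟩
  simpa [hx] using h x

theorem lpNorm_mulVec_le_opNorm {p : ℝ≥0∞} (hp : 1 ≤ p) (A : Matrix ι ι ℂ) {x : ι → ℂ}
    (hx : lpNorm p x = 1) : lpNorm p (A *ᵥ x) ≤ opNorm p A := by
  have : Fact (1 ≤ p) := ⟨hp⟩
  let L : PiLp p (fun _ : ι => ℂ) →L[ℂ] PiLp p (fun _ : ι => ℂ) :=
    LinearMap.toContinuousLinearMap ((WithLp.linearEquiv p ℂ (ι → ℂ)).symm.toLinearMap ∘ₗ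
      A.mulVecLin ∘ₗ (WithLp.linearEquiv p ℂ (ι → ℂ)).toLinearMap)
  refine le_csSup ⟨‖L‖, ?_⟩ ⟨x, hx, rfl⟩
  rintro r ⟨y, hy, rfl⟩
  rw [lpNorm_eq_norm_toLp] at hy ⊢
  have hLy := L.le_opNorm (WithLp.toLp p y)
  rwa [hy, mul_one] at hLy

theorem lpNorm_mulVec_le {p : ℝ≥0∞} (hp : 1 ≤ p) (A : Matrix ι ι ℂ) (x : ι → ℂ) :
    lpNorm p (A *ᵥ x) ≤ opNorm p A * lpNorm p x := by
  rcases (lpNorm_nonneg p x).eq_or_lt' with h | h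
  · have hx : x = 0 := by
      ext i
      exact norm_le_zero_iff.1 ((norm_le_lpNorm hp x i).trans h.le)
    rw [hx, Matrix.mulVec_zero, lpNorm_zero hp, mul_zero]
  · have hn : ‖(lpNorm p x : ℂ)‖ = lpNorm p x := by
      rw [Complex.norm_real, Real.norm_of_nonneg h.le]
    have := lpNorm_mulVec_le_opNorm hp A (x := (lpNorm p x : ℂ)⁻¹ • x)
      (by rw [lpNorm_smul hp, norm_inv, hn, inv_mul_cancel₀ h.ne'])
    rwa [Matrix.mulVec_smul, lpNorm_smul hp, norm_inv, hn, inv_mul_le_iff₀' h] at this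

theorem opNorm_conjTranspose_le {p q : ℝ≥0∞} (h : p.HolderConjugate q) (A : Matrix ι ι ℂ) :
    opNorm q Aᴴ ≤ opNorm p A := by
  have hp := ENNReal.HolderConjugate.one_le p q
  refine opNorm_le_of_forall (opNorm_nonneg _ _) fun y => ?_
  obtain ⟨x, hx, hxy⟩ := exists_norming h (Aᴴ *ᵥ y)
  calc lpNorm q (Aᴴ *ᵥ y) = ‖star x ⬝ᵥ Aᴴ *ᵥ y‖ := by
        rw [hxy, Complex.norm_real, Real.norm_of_nonneg (lpNorm_nonneg _ _)]
    _ = ‖star (A *ᵥ x) ⬝ᵥ y‖ := by rw [Matrix.star_mulVec, Matrix.dotProduct_mulVec]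
    _ ≤ ∑ i, ‖(A *ᵥ x) i‖ * ‖y i‖ := by
        refine (norm_sum_le _ _).trans_eq (Finset.sum_congr rfl fun i _ => ?_)
        rw [norm_mul, Pi.star_apply, norm_star]
    _ ≤ lpNorm p (A *ᵥ x) * lpNorm q y := sum_norm_mul_norm_le h _ _
    _ ≤ opNorm p A * lpNorm q y := by
        gcongr
        · exact lpNorm_nonneg _ _
        · exact (lpNorm_mulVec_le hp A x).trans (mul_le_of_le_one_right (opNorm_nonneg _ _) hx)

theorem opNorm_conjTranspose {p q : ℝ≥0∞} (h : p.HolderConjugate q) (A : Matrix ι ι ℂ) :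
    opNorm q Aᴴ = opNorm p A := by
  refine le_antisymm (opNorm_conjTranspose_le h A) ?_
  simpa using opNorm_conjTranspose_le h.symm Aᴴ

end OpNorm

section BlockColumn

variable {ι κ : Type*} [Fintype ι] [Fintype κ] [DecidableEq κ]

/-- The block matrix whose block column `a` consists of the blocks `A i`, all other blocks being
zero. -/
def blockColumn (a : κ) (A : κ → Matrix ι ι ℂ) : Matrix (κ × ι) (κ × ι) ℂ :=
  Matrix.of fun x y => if y.1 = a then A x.1 x.2 y.2 else 0

theorem blockColumn_mulVec (a : κ) (A : κ → Matrix ι ι ℂ) (x : κ × ι → ℂ) (i : κ) (j : ι) :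
    (blockColumn a A *ᵥ x) (i, j) = (A i *ᵥ fun l => x (a, l)) j := by
  simp only [blockColumn, Matrix.mulVec, dotProduct, Matrix.of_apply, Fintype.sum_prod_type,
    ite_mul, zero_mul]
  rw [Finset.sum_comm]
  simp

theorem lpNorm_blockColumn_mulVec {p : ℝ≥0∞} (hp : 1 ≤ p) (a : κ) (A : κ → Matrix ι ι ℂ)
    (x : κ × ι → ℂ) :
    lpNorm p (blockColumn a A *ᵥ x) = lpNorm p fun i => lpNorm p (A i *ᵥ fun l => x (a, l)) := by
  simp_rw [lpNorm_prod hp, blockColumn_mulVec]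

theorem opNorm_blockColumn_le {p : ℝ≥0∞} (hp : 1 ≤ p) (a : κ) (A : κ → Matrix ι ι ℂ) :
    opNorm p (blockColumn a A) ≤ lpNorm p fun i => opNorm p (A i) := by
  refine opNorm_le_of_forall (lpNorm_nonneg _ _) fun x => ?_
  have hxa : lpNorm p (fun l => x (a, l)) ≤ lpNorm p x := by
    rw [lpNorm_prod hp x]
    exact (Real.le_norm_self _).trans
      (norm_le_lpNorm hp (fun i => lpNorm p fun l => x (i, l)) a)
  calc lpNorm p (blockColumn a A *ᵥ x)
      = lpNorm p fun i => lpNorm p (A i *ᵥ fun l => x (a, l)) :=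
        lpNorm_blockColumn_mulVec hp a A x
    _ ≤ lpNorm p (lpNorm p x • fun i => opNorm p (A i)) := by
        refine lpNorm_mono p fun i => ?_
        rw [Real.norm_of_nonneg (lpNorm_nonneg _ _), Pi.smul_apply, smul_eq_mul, mul_comm]
        refine ((lpNorm_mulVec_le hp (A i) _).trans ?_).trans (Real.le_norm_self _)
        exact mul_le_mul_of_nonneg_left hxa (opNorm_nonneg _ _)
    _ = (lpNorm p fun i => opNorm p (A i)) * lpNorm p x := by
        rw [lpNorm_smul hp, Real.norm_of_nonneg (lpNorm_nonneg _ _), mul_comm]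

theorem opNorm_blockColumn_eq {p : ℝ≥0∞} (hp : 1 ≤ p) (a : κ) (A : κ → Matrix ι ι ℂ)
    (h : ∃ ξ : ι → ℂ, lpNorm p ξ = 1 ∧ ∀ i, lpNorm p (A i *ᵥ ξ) = opNorm p (A i)) :
    opNorm p (blockColumn a A) = lpNorm p fun i => opNorm p (A i) := by
  obtain ⟨ξ, hξ, hA⟩ := h
  refine le_antisymm (opNorm_blockColumn_le hp a A) ?_
  let x : κ × ι → ℂ := fun y => if y.1 = a then ξ y.2 else 0
  have hx : lpNorm p x = 1 := by
    rw [lpNorm_prod hp, show (fun i => lpNorm p fun j => x (i, j)) = Pi.single a (1 : ℝ) from ?_,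
      lpNorm_single hp, norm_one]
    ext i
    rcases eq_or_ne i a with rfl | hi
    · simpa [x] using hξ
    · simp only [x, if_neg hi, Pi.single_eq_of_ne hi]
      exact lpNorm_zero hp
  have hle := lpNorm_mulVec_le_opNorm hp (blockColumn a A) hx
  rw [lpNorm_blockColumn_mulVec hp] at hle
  simpa [x, hA] using hle

theorem opNorm_blockRow {p q : ℝ≥0∞} (h : p.HolderConjugate q) (a : κ)
    (A : κ → Matrix ι ι ℂ) :
    opNorm p (Matrix.of fun x y : κ × ι => if x.1 = a then A y.1 x.2 y.2 else 0) =
      opNorm q (blockColumn a fun i => (A i)ᴴ) := by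
  rw [← opNorm_conjTranspose h]
  congr 1
  ext x y
  simp only [blockColumn, Matrix.conjTranspose_apply, Matrix.of_apply]
  split_ifs <;> simp

end BlockColumn

theorem statement19 {n k : ℕ} (hk : 0 < k) (A : Fin k → Matrix (Fin n) (Fin n) ℂ)
    (p q : ℝ≥0∞) (hp : 1 ≤ p) (hq : 1 ≤ q) (hpq : 1 / p + 1 / q = 1) :
    (opNorm p (Matrix.of fun x y : Fin k × Fin n =>
        if (y.1 : ℕ) = 0 then A x.1 x.2 y.2 else 0) ≤
        lpNorm p (fun i => opNorm p (A i)) ∧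
      opNorm p (Matrix.of fun x y : Fin k × Fin n =>
        if (x.1 : ℕ) = 0 then A y.1 x.2 y.2 else 0) ≤
        lpNorm q (fun i => opNorm p (A i))) ∧
    ((∃ ξ : Fin n → ℂ, lpNorm p ξ = 1 ∧
        ∀ i, lpNorm p ((A i).mulVec ξ) = opNorm p (A i)) →
      opNorm p (Matrix.of fun x y : Fin k × Fin n =>
        if (y.1 : ℕ) = 0 then A x.1 x.2 y.2 else 0) =
        lpNorm p (fun i => opNorm p (A i))) ∧
    ((∃ η : Fin n → ℂ, lpNorm q η = 1 ∧
        ∀ i, lpNorm q ((A i)ᴴ.mulVec η) = opNorm q (A i)ᴴ) →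
      opNorm p (Matrix.of fun x y : Fin k × Fin n =>
        if (x.1 : ℕ) = 0 then A y.1 x.2 y.2 else 0) =
        lpNorm q (fun i => opNorm p (A i))) := by
  have h : p.HolderConjugate q := ENNReal.holderConjugate_iff.2 (by simpa using hpq)
  have hzero (i : Fin k) : (i : ℕ) = 0 ↔ i = ⟨0, hk⟩ := by rw [Fin.ext_iff]
  have hB : (Matrix.of fun x y : Fin k × Fin n =>
      if (y.1 : ℕ) = 0 then A x.1 x.2 y.2 else 0) = blockColumn ⟨0, hk⟩ A := by
    simp only [hzero, blockColumn]
  have hC : opNorm p (Matrix.of fun x y : Fin k × Fin n =>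
      if (x.1 : ℕ) = 0 then A y.1 x.2 y.2 else 0) =
        opNorm q (blockColumn ⟨0, hk⟩ fun i => (A i)ᴴ) := by
    rw [← opNorm_blockRow h]
    simp only [hzero]
  have hA : (fun i => opNorm p (A i)) = fun i => opNorm q (A i)ᴴ :=
    funext fun i => (opNorm_conjTranspose h (A i)).symm
  rw [hB, hC]
  refine ⟨⟨opNorm_blockColumn_le hp _ A, ?_⟩, opNorm_blockColumn_eq hp _ A, fun hη => ?_⟩
  · rw [hA]
    exact opNorm_blockColumn_le hq _ _
  · rw [hA]
    exact opNorm_blockColumn_eq hq _ _ hη
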